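/- Let a and b be coprime integers with a ≥ 2 and b ≥ 2. Then there exists an integer s with 1 < s < 2·a·b − 1 such that s ≡ −1 (mod 2·a), s ≡ 1 (mod 2·b), and s² ≡ 1 (mod 4·a·b). -/

import Mathlib

theorem rectangular_satin_offset_exists (a b : ℤ) (hab : IsCoprime a b)
    (ha : 2 ≤ a) (hb : 2 ≤ b) :
    ∃ s : ℤ, 1 < s ∧ s < 2 * a * b - 1 ∧
      s ≡ -1 [ZMOD 2 * a] ∧ s ≡ 1 [ZMOD 2 * b] ∧
      s ^ 2 ≡ 1 [ZMOD 4 * a * b] := by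
  obtain ⟨u, v, h⟩ := hab
  obtain ⟨c, d, hcd, h0, h1⟩ : ∃ c d : ℤ, c * a = 1 + b * d ∧ 0 ≤ c ∧ c < b := by
    refine ⟨u % b, -((u / b) * a + v), ?_, Int.emod_nonneg _ (by omega),
      Int.emod_lt_of_pos _ (by omega)⟩
    have := Int.emod_add_mul_ediv u b
    linear_combination h + a * this
  have hc : 1 ≤ c := by
    by_contra hlt
    have hc0 : c = 0 := by omega
    subst hc0
    have hdvd : b ∣ 1 := ⟨-d, by linarith⟩
    have := Int.le_of_dvd one_pos hdvd
    omega
  refine ⟨2 * a * c - 1, by nlinarith, by nlinarith, ?_, ?_, ?_⟩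
  · exact (Int.modEq_iff_dvd.2 ⟨c, by ring⟩).symm
  · exact (Int.modEq_iff_dvd.2 ⟨d, by linear_combination 2 * hcd⟩).symm
  · exact (Int.modEq_iff_dvd.2 ⟨c * d, by linear_combination 4 * a * c * hcd⟩).symm
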